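/- arXiv:2605.18590 — 3 statements merged into one kernel-verified Lean document; each statement's English description precedes it below -/
import Mathlib

section
/- Let p ≥ 2 be an integer and let f(z) = z^p + ∑_{n=p+1}^∞ a_n z^n be analytic in the open unit disc 𝔻. Let α₀ ∈ (0, 3/2] and let α : {0,1,…,p} → ℝ be the sequence of positive reals with α_0 = α₀ and α_k + (2/π)·arctan(α_k / k) = α_{k-1} for k = 1, …, p. If |arg f^{(p)}(z)| < π·α₀/2 for all z ∈ 𝔻, then for every s ∈ {2, …, p}, |arg( z·f^{(p-s+1)}(z)/f^{(p-s)}(z) )| < (π/2)(α_s + α_{s-1}) for all z ∈ 𝔻, z ≠ 0. -/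
open Complex Real

open Metric Topology Filter in
/-- A holomorphic function on the unit disc vanishing to order `s` at the origin is `z ^ s` times a
holomorphic function. -/
lemma exists_eq_pow_mul_of_iteratedDeriv_eq_zero {g : ℂ → ℂ} {s : ℕ}
    (hg : DifferentiableOn ℂ g (ball 0 1)) (h0 : ∀ i < s, iteratedDeriv i g 0 = 0) :
    ∃ q : ℂ → ℂ, DifferentiableOn ℂ q (ball 0 1) ∧ ∀ z ∈ ball (0 : ℂ) 1, g z = z ^ s * q z := by
  have hg0 : AnalyticAt ℂ g 0 := hg.analyticAt (isOpen_ball.mem_nhds (by simp))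
  obtain ⟨G, hG, hgG⟩ := (natCast_le_analyticOrderAt hg0).1
    ((natCast_le_analyticOrderAt_iff_iteratedDeriv_eq_zero hg0).2 h0)
  simp only [sub_zero, smul_eq_mul] at hgG
  refine ⟨fun z => if z = 0 then G 0 else g z / z ^ s, fun z hz => ?_, fun z hz => ?_⟩
  · apply DifferentiableAt.differentiableWithinAt
    by_cases hz0 : z = 0
    · subst hz0
      refine hG.differentiableAt.congr_of_eventuallyEq ?_
      filter_upwards [hgG] with w hw
      by_cases hw0 : w = 0
      · simp [hw0]
      · simp only [hw0, if_false]
        rw [hw]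
        field_simp
    · have h1 : DifferentiableAt ℂ (fun w => g w / w ^ s) z :=
        ((hg z hz).differentiableAt (isOpen_ball.mem_nhds hz)).div (by fun_prop)
          (pow_ne_zero _ hz0)
      refine h1.congr_of_eventuallyEq ?_
      filter_upwards [isOpen_ne.mem_nhds hz0] with w hw
      simp [show w ≠ 0 from hw]
  · by_cases hz0 : z = 0
    · subst hz0
      simpa using hgG.self_of_nhds
    · simp only [hz0, if_false]
      field_simp

lemma cos_two_mul_arctan (t : ℝ) : Real.cos (2 * Real.arctan t) = (1 - t ^ 2) / (1 + t ^ 2) := by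
  rw [Real.cos_two_mul, Real.cos_sq_arctan]
  have : (1 + t ^ 2) ≠ 0 := by positivity
  field_simp
  ring

/-- If `exp w` lies in the right half plane and its Cayley transform has modulus at most `t`, then
the imaginary part of `w` is bounded by `2 arctan t`. -/
lemma abs_im_le_two_mul_arctan {w : ℂ} {t : ℝ} (ht : 0 ≤ t) (ht1 : t ≤ 1)
    (hw : |w.im| < π / 2) (h : ‖exp w - 1‖ ≤ t * ‖exp w + 1‖) :
    |w.im| ≤ 2 * Real.arctan t := by
  have hr : 0 < Real.exp w.re := Real.exp_pos _
  have h2 : ‖exp w - 1‖ ^ 2 ≤ (t * ‖exp w + 1‖) ^ 2 := by gcongr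
  rw [mul_pow, Complex.sq_norm, Complex.sq_norm, Complex.normSq_apply, Complex.normSq_apply] at h2
  simp only [sub_re, sub_im, add_re, add_im, one_re, one_im, Complex.exp_re, Complex.exp_im] at h2
  set ρ := Real.exp w.re
  have hcs := Real.sin_sq_add_cos_sq w.im
  set c := Real.cos w.im with hc
  set s := Real.sin w.im
  have hcpos : (1 - t ^ 2) / (1 + t ^ 2) ≤ c := by
    rw [div_le_iff₀ (by positivity)]
    have e : (1 - t ^ 2) * (ρ ^ 2 + 1) ≤ 2 * ρ * (c * (1 + t ^ 2)) := by
      have hs : s ^ 2 = 1 - c ^ 2 := by linarith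
      have e1 : ρ * s * (ρ * s) = ρ ^ 2 * (1 - c ^ 2) := by rw [← hs]; ring
      have := h2
      simp only [sub_zero, add_zero] at this
      rw [e1] at this
      nlinarith [this]
    have e2 : (1 - t ^ 2) * (2 * ρ) ≤ (1 - t ^ 2) * (ρ ^ 2 + 1) :=
      mul_le_mul_of_nonneg_left (by nlinarith [sq_nonneg (ρ - 1)]) (by nlinarith)
    have e3 : (2 * ρ) * (1 - t ^ 2) ≤ (2 * ρ) * (c * (1 + t ^ 2)) := by linarith
    exact le_of_mul_le_mul_left e3 (by positivity)
  rw [← cos_two_mul_arctan, hc, ← Real.cos_abs w.im] at hcpos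
  by_contra! hlt
  have h3 := Real.cos_lt_cos_of_nonneg_of_le_pi
    (mul_nonneg zero_le_two (Real.arctan_nonneg.2 ht)) (by linarith [Real.pi_pos]) hlt
  linarith

open Metric in
/-- Growth of the argument of a holomorphic function with values in a sector. -/
lemma abs_arg_le_two_mul_arctan {q : ℂ → ℂ} {r β : ℝ} (hβ : 0 < β) (hβ1 : β ≤ 1)
    (hq : DifferentiableOn ℂ q (ball 0 r)) (hq0 : q 0 = 1)
    (hs : ∀ z ∈ ball (0 : ℂ) r, q z ≠ 0 ∧ |arg (q z)| < π * β / 2) {z : ℂ}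
    (hz : z ∈ ball (0 : ℂ) r) :
    |arg (q z)| ≤ 2 * β * Real.arctan (‖z‖ / r) := by
  have hr : 0 < r := pos_of_mem_ball hz
  have hzr : ‖z‖ < r := by simpa using hz
  have hslit : ∀ z ∈ ball (0 : ℂ) r, q z ∈ slitPlane := fun w hw => by
    rw [mem_slitPlane_iff_arg]
    refine ⟨fun h => ?_, (hs w hw).1⟩
    have := (hs w hw).2
    rw [h, abs_of_pos Real.pi_pos] at this
    nlinarith [Real.pi_pos]
  set W : ℂ → ℂ := fun z => Complex.log (q z) / β with hW
  have hWim : ∀ z, (W z).im = arg (q z) / β := fun z => by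
    simp only [hW]; rw [Complex.div_ofReal_im, Complex.log_im]
  have hWlt : ∀ z ∈ ball (0 : ℂ) r, |(W z).im| < π / 2 := fun w hw => by
    rw [hWim, abs_div, abs_of_pos hβ, div_lt_iff₀ hβ]
    linarith [(hs w hw).2]
  have hre : ∀ z ∈ ball (0 : ℂ) r, 0 < (exp (W z)).re := fun w hw => by
    rw [Complex.exp_re]
    exact mul_pos (Real.exp_pos _) (Real.cos_pos_of_mem_Ioo (abs_lt.1 (hWlt w hw)))
  have hne : ∀ z ∈ ball (0 : ℂ) r, exp (W z) + 1 ≠ 0 := fun w hw h => by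
    have h1 := congrArg Complex.re h
    simp only [add_re, one_re, zero_re] at h1
    linarith [hre w hw]
  have hWd : DifferentiableOn ℂ W (ball 0 r) := (hq.clog hslit).div_const _
  set φ : ℂ → ℂ := fun z => (exp (W z) - 1) / (exp (W z) + 1) with hφ
  have hφd : DifferentiableOn ℂ φ (ball 0 r) :=
    (hWd.cexp.sub_const 1).div (hWd.cexp.add_const 1) hne
  have hφ0 : φ 0 = 0 := by simp [hφ, hW, hq0]
  have hmaps : Set.MapsTo φ (ball 0 r) (ball (φ 0) 1) := fun w hw => by
    rw [hφ0, mem_ball_zero_iff]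
    simp only [hφ]
    rw [norm_div, div_lt_one (norm_pos_iff.2 (hne w hw))]
    apply lt_of_pow_lt_pow_left₀ 2 (norm_nonneg _)
    rw [Complex.sq_norm, Complex.sq_norm, Complex.normSq_apply, Complex.normSq_apply]
    simp only [sub_re, sub_im, add_re, add_im, one_re, one_im]
    nlinarith [hre w hw]
  have hsch := Complex.dist_le_div_mul_dist_of_mapsTo_ball hφd
    (hmaps.mono_right ball_subset_closedBall) hz
  rw [hφ0, dist_zero_right, dist_zero_right] at hsch
  have hφz : ‖φ z‖ = ‖exp (W z) - 1‖ / ‖exp (W z) + 1‖ := norm_div _ _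
  rw [hφz, div_le_iff₀ (norm_pos_iff.2 (hne z hz)), one_div_mul_eq_div] at hsch
  have hfin := abs_im_le_two_mul_arctan (by positivity) ((div_le_one hr).2 hzr.le)
    (hWlt z hz) hsch
  rw [hWim, abs_div, abs_of_pos hβ, div_le_iff₀ hβ] at hfin
  linarith

open Filter Topology in
/-- One-sided first derivative test. -/
lemma nonneg_of_hasDerivAt_of_eventually_le_left {v : ℝ → ℝ} {v' x : ℝ} (hv : HasDerivAt v v' x)
    (h : ∀ᶠ t in 𝓝[<] x, v t ≤ v x) : 0 ≤ v' := by
  have h1 := (hasDerivAt_iff_tendsto_slope_left_right.1 hv).1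
  refine ge_of_tendsto h1 ?_
  filter_upwards [h, self_mem_nhdsWithin] with t ht htx
  rw [slope_def_field]
  exact div_nonneg_of_nonpos (by linarith) (by linarith [show t < x from htx])

open Filter Topology in
/-- Derivative information at a boundary point `z₀` of a disc, from comparison of the imaginary
part of a holomorphic function with its value at `z₀`. -/
lemma re_eq_zero_and_le_im_of_im_le {F : ℂ → ℂ} {z₀ d : ℂ} {ψ : ℝ → ℝ} {b : ℝ} (hz₀ : z₀ ≠ 0)
    (hF : HasDerivAt F d z₀) (hψ : HasDerivAt ψ b 0)
    (hle : ∀ z, ‖z‖ < ‖z₀‖ → (F z).im ≤ (F z₀).im)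
    (hψ0 : ψ 0 ≤ (F z₀).im)
    (hψle : ∀ t : ℝ, -1 < t → t < 0 → (F (z₀ * (1 + t))).im ≤ ψ t) :
    (z₀ * d).re = 0 ∧ b ≤ (z₀ * d).im := by
  have key : ∀ w : ℂ, HasDerivAt (fun t : ℝ => (F (z₀ * (1 + t * w))).im) (z₀ * d * w).im 0 := by
    intro w
    have h1 : HasDerivAt (fun t : ℝ => z₀ * (1 + (t : ℂ) * w)) (z₀ * w) 0 := by
      have := (((Complex.ofRealCLM.hasDerivAt (x := (0 : ℝ))).mul_const w).const_add 1).const_mul z₀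
      simpa using this
    have h2 : HasDerivAt F d (z₀ * (1 + ((0 : ℝ) : ℂ) * w)) := by simpa using hF
    have h3 := h2.comp (0 : ℝ) h1
    have h4 := Complex.imCLM.hasFDerivAt.comp_hasDerivAt (0 : ℝ) h3
    refine (h4 : HasDerivAt (fun t : ℝ => (F (z₀ * (1 + t * w))).im) _ 0).congr_deriv ?_
    change (d * (z₀ * w)).im = _
    congr 1
    ring
  have hinner : ∀ w : ℂ, 0 < w.re → 0 ≤ (z₀ * d * w).im := by
    intro w hw
    refine nonneg_of_hasDerivAt_of_eventually_le_left (key w) ?_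
    have hnear : ∀ᶠ t in 𝓝[<] (0 : ℝ), -(2 * w.re / (normSq w + 1)) < t :=
      nhdsWithin_le_nhds (lt_mem_nhds (neg_lt_zero.2
        (div_pos (by linarith) (by linarith [normSq_nonneg w]))))
    filter_upwards [hnear, self_mem_nhdsWithin] with t ht ht0
    have ht0 : t < 0 := ht0
    have hN := normSq_nonneg w
    have hlt : ‖1 + (t : ℂ) * w‖ < 1 := by
      apply lt_of_pow_lt_pow_left₀ 2 zero_le_one
      rw [Complex.sq_norm, Complex.normSq_apply]
      simp only [add_re, one_re, mul_re, ofReal_re, ofReal_im, add_im, one_im, mul_im]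
      rw [neg_lt, lt_div_iff₀ (by linarith)] at ht
      rw [Complex.normSq_apply] at ht
      nlinarith
    simp only [ofReal_zero, zero_mul, add_zero, mul_one]
    apply hle
    rw [norm_mul]
    exact mul_lt_of_lt_one_right (norm_pos_iff.2 hz₀) hlt
  constructor
  · set a := (z₀ * d).re
    set e := (z₀ * d).im
    have h1 : ∀ y : ℝ, 0 ≤ e + a * y := fun y => by
      have := hinner (1 + y * I) (by simp)
      rw [mul_im, show (1 + y * I : ℂ).re = 1 by simp, show (1 + y * I : ℂ).im = y by simp] at this
      linarith
    by_contra ha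
    have := h1 (-(e + 1) / a)
    rw [mul_div_cancel₀ _ ha] at this
    linarith
  · have h1 := (key 1).sub hψ
    rw [mul_one] at h1
    have := nonneg_of_hasDerivAt_of_eventually_le_left h1 ?_
    · linarith
    · have hnear : ∀ᶠ t in 𝓝[<] (0 : ℝ), -1 < t :=
        nhdsWithin_le_nhds (lt_mem_nhds (by norm_num))
      filter_upwards [hnear, self_mem_nhdsWithin] with t ht ht0
      have := hψle t ht ht0
      simp only [Pi.sub_apply, mul_one, ofReal_zero, add_zero]
      linarith

lemma arg_one_add_mul_I (y : ℝ) : arg (1 + y * I) = Real.arctan y := by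
  have h1 : |arg (1 + y * I)| < π / 2 := abs_arg_lt_pi_div_two_iff.2 (Or.inl (by simp))
  rw [abs_lt] at h1
  rw [← Real.arctan_tan h1.1 h1.2, Complex.tan_arg]
  simp

lemma arg_mul_one_add_mul_I {w : ℂ} (hw : w ≠ 0) (hre : 0 ≤ w.re) (y : ℝ) :
    arg (w * (1 + y * I)) = arg w + Real.arctan y := by
  have h1 := abs_le.1 (abs_arg_le_pi_div_two_iff.2 hre)
  have h2 : (1 + y * I : ℂ) ≠ 0 := fun h => by simpa using congrArg Complex.re h
  rw [Complex.arg_mul hw h2, arg_one_add_mul_I]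
  rw [arg_one_add_mul_I]
  constructor <;> linarith [Real.neg_pi_div_two_lt_arctan y, Real.arctan_lt_pi_div_two y]

/-- Derivative information at the first boundary point where a holomorphic function leaves a sector
through one of its sides. -/
lemma exists_mul_deriv_eq_of_le_arg {q : ℂ → ℂ} {β σ : ℝ} {z₀ : ℂ} (hβ : 0 < β) (hβ1 : β ≤ 1)
    (hσ : |σ| = 1) (hq : DifferentiableOn ℂ q (Metric.ball 0 1)) (hq0 : q 0 = 1)
    (hz₀ : z₀ ≠ 0) (hz₀1 : ‖z₀‖ < 1)
    (hs : ∀ z, ‖z‖ < ‖z₀‖ → q z ≠ 0 ∧ |arg (q z)| < π * β / 2)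
    (hslit : q z₀ ∈ slitPlane) (harg : π * β / 2 ≤ σ * arg (q z₀)) :
    ∃ m : ℝ, β ≤ σ * m ∧ z₀ * deriv q z₀ = q z₀ * (m * I) := by
  have hmem : z₀ ∈ Metric.ball (0 : ℂ) 1 := by simpa using hz₀1
  have hd := ((hq z₀ hmem).differentiableAt (Metric.isOpen_ball.mem_nhds hmem)).hasDerivAt
  have hne : q z₀ ≠ 0 := slitPlane_ne_zero hslit
  have hr : 0 < ‖z₀‖ := norm_pos_iff.2 hz₀
  have hF : HasDerivAt (fun z => (σ : ℂ) * Complex.log (q z)) (σ * (deriv q z₀ / q z₀)) z₀ :=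
    (hd.clog hslit).const_mul _
  have hFim : ∀ z, ((σ : ℂ) * Complex.log (q z)).im = σ * arg (q z) := fun z => by
    rw [im_ofReal_mul, Complex.log_im]
  have hσle : ∀ x : ℝ, σ * x ≤ |x| := fun x => by
    have := le_abs_self (σ * x)
    rwa [abs_mul, hσ, one_mul] at this
  have hψ : HasDerivAt (fun t : ℝ => 2 * β * Real.arctan (1 + t)) β 0 := by
    have h1 := (((hasDerivAt_id (0 : ℝ)).const_add 1).arctan).const_mul (2 * β)
    refine h1.congr_deriv ?_
    norm_num
    ring
  have hqr : DifferentiableOn ℂ q (Metric.ball 0 ‖z₀‖) :=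
    hq.mono (Metric.ball_subset_ball hz₀1.le)
  obtain ⟨h1, h2⟩ := re_eq_zero_and_le_im_of_im_le hz₀ hF hψ
    (fun z hz => by
      rw [hFim, hFim]
      linarith [hσle (arg (q z)), (hs z hz).2])
    (by
      rw [hFim]
      simp only [add_zero, Real.arctan_one]
      linarith)
    (fun t ht ht0 => by
      have hn : ‖z₀ * (1 + (t : ℂ))‖ = ‖z₀‖ * (1 + t) := by
        rw [norm_mul, ← ofReal_one, ← ofReal_add, Complex.norm_of_nonneg (by linarith)]
      rw [hFim]
      refine (hσle _).trans ?_
      have := abs_arg_le_two_mul_arctan hβ hβ1 hqr hq0 (fun z hz => hs z (by simpa using hz))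
        (z := z₀ * (1 + t)) (by rw [mem_ball_zero_iff, hn]; nlinarith)
      rwa [hn, mul_div_cancel_left₀ _ hr.ne'] at this)
  have hσ0 : σ ≠ 0 := fun h => by simp [h] at hσ
  rw [mul_left_comm, re_ofReal_mul] at h1
  rw [mul_left_comm, im_ofReal_mul] at h2
  refine ⟨(z₀ * (deriv q z₀ / q z₀)).im, h2, ?_⟩
  have h3 : z₀ * (deriv q z₀ / q z₀) = ((z₀ * (deriv q z₀ / q z₀)).im : ℂ) * I := by
    apply Complex.ext
    · rw [(mul_eq_zero.1 h1).resolve_left hσ0]; simp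
    · simp
  rw [← h3]
  field_simp

/-- If a holomorphic function maps a disc to the right half plane and vanishes at a boundary point
`z₀`, then `z₀` times its derivative at `z₀` is a nonpositive real. -/
lemma mul_deriv_nonpos_of_re_nonneg {q : ℂ → ℂ} {z₀ d : ℂ} (hz₀ : z₀ ≠ 0)
    (hd : HasDerivAt q d z₀) (hs : ∀ z, ‖z‖ < ‖z₀‖ → 0 ≤ (q z).re) (h0 : q z₀ = 0) :
    (z₀ * d).im = 0 ∧ (z₀ * d).re ≤ 0 := by
  have hr : 0 < ‖z₀‖ := norm_pos_iff.2 hz₀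
  have hF : HasDerivAt (fun z => -I * q z) (-I * d) z₀ := hd.const_mul _
  have hFim : ∀ z, (-I * q z).im = -(q z).re := fun z => by simp
  obtain ⟨h1, h2⟩ := re_eq_zero_and_le_im_of_im_le (ψ := fun _ => 0) (b := 0) hz₀ hF
    (hasDerivAt_const _ _)
    (fun z hz => by rw [hFim, hFim, h0]; simpa using hs z hz)
    (by rw [hFim, h0]; simp)
    (fun t ht ht0 => by
      rw [hFim]
      have hn : ‖z₀ * (1 + (t : ℂ))‖ = ‖z₀‖ * (1 + t) := by
        rw [norm_mul, ← ofReal_one, ← ofReal_add, Complex.norm_of_nonneg (by linarith)]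
      have := hs (z₀ * (1 + t)) (by rw [hn]; nlinarith)
      linarith)
  rw [mul_left_comm] at h1 h2
  generalize z₀ * d = D at h1 h2 ⊢
  simp at h1 h2
  exact ⟨h1, h2⟩

open Metric Topology in
/-- Nunokawa's argument lemma: a bound on the argument of `q z + z * deriv q z / k` gives one for that
of `q z`. -/
lemma abs_arg_lt_of_abs_arg_add_mul_deriv_lt {q : ℂ → ℂ} {k β : ℝ} (hk : 0 < k) (hβ : 0 < β)
    (hβ1 : β ≤ 1) (hq : DifferentiableOn ℂ q (ball 0 1)) (hq0 : q 0 = 1)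
    (hQ : ∀ z ∈ ball (0 : ℂ) 1, q z + z * deriv q z / k ≠ 0 ∧
      |arg (q z + z * deriv q z / k)| < π * β / 2 + Real.arctan (β / k)) :
    ∀ z ∈ ball (0 : ℂ) 1, q z ≠ 0 ∧ |arg (q z)| < π * β / 2 := by
  have hπ := Real.pi_pos
  have hc : π * β / 2 ≤ π / 2 := by nlinarith
  have hgood_re : ∀ z, q z ≠ 0 ∧ |arg (q z)| < π * β / 2 → 0 < (q z).re := fun z hz =>
    (abs_arg_lt_pi_div_two_iff.1 (hz.2.trans_le hc)).resolve_right hz.1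
  by_contra! hbad
  obtain ⟨z₁, hz₁, hbad⟩ := hbad
  have hz₁' : ‖z₁‖ < 1 := by simpa using hz₁
  set G : Set ℂ := {z | q z ≠ 0 ∧ |arg (q z)| < π * β / 2} with hG
  have hGnhds : ∀ z ∈ G, z ∈ ball (0 : ℂ) 1 → G ∈ 𝓝 z := fun z hz hz1 => by
    have hcont : ContinuousAt q z :=
      ((hq z hz1).differentiableAt (isOpen_ball.mem_nhds hz1)).continuousAt
    have harg : ContinuousAt (fun w => |arg (q w)|) z :=
      ((Complex.continuousAt_arg (mem_slitPlane_iff.2 (Or.inl (hgood_re z hz)))).comp hcont).abs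
    filter_upwards [hcont.eventually_ne hz.1, harg.eventually (gt_mem_nhds hz.2)] with w h1 h2
    exact ⟨h1, h2⟩
  have hKeq : closedBall (0 : ℂ) ‖z₁‖ \ G = closedBall (0 : ℂ) ‖z₁‖ \ interior G := by
    ext z
    simp only [Set.mem_sdiff, mem_closedBall_zero_iff]
    refine ⟨fun h => ⟨h.1, fun h' => h.2 (interior_subset h')⟩, fun h => ⟨h.1, fun h' => h.2 ?_⟩⟩
    exact mem_interior_iff_mem_nhds.2 (hGnhds z h' (by simpa using h.1.trans_lt hz₁'))
  have hK : IsCompact (closedBall (0 : ℂ) ‖z₁‖ \ G) := by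
    rw [hKeq]
    exact (isCompact_closedBall _ _).diff isOpen_interior
  have hz₁G : z₁ ∉ G := fun h => absurd h.2 (not_lt.2 (hbad h.1))
  obtain ⟨z₀, hz₀K, hmin⟩ := hK.exists_isMinOn ⟨z₁, by simp, hz₁G⟩ continuous_norm.continuousOn
  have hz₀le : ‖z₀‖ ≤ ‖z₁‖ := by simpa using hz₀K.1
  have hz₀1 : ‖z₀‖ < 1 := hz₀le.trans_lt hz₁'
  have hz₀mem : z₀ ∈ ball (0 : ℂ) 1 := by simpa using hz₀1
  have hs : ∀ z, ‖z‖ < ‖z₀‖ → q z ≠ 0 ∧ |arg (q z)| < π * β / 2 := fun z hz => by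
    by_contra hzG
    exact absurd (hmin (show z ∈ closedBall (0 : ℂ) ‖z₁‖ \ G from
      ⟨by simpa using hz.le.trans hz₀le, hzG⟩)) (not_le.2 hz)
  have hz₀ : z₀ ≠ 0 := fun h => hz₀K.2 (by
    rw [h]
    refine ⟨by simp [hq0], ?_⟩
    rw [hq0, arg_one, abs_zero]
    positivity)
  have hr : ‖z₀‖ ≠ 0 := norm_ne_zero_iff.2 hz₀
  have hdiff : DifferentiableAt ℂ q z₀ :=
    (hq z₀ hz₀mem).differentiableAt (isOpen_ball.mem_nhds hz₀mem)
  have hre : 0 ≤ (q z₀).re := by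
    have hcl : z₀ ∈ closure (ball (0 : ℂ) ‖z₀‖) := by
      rw [closure_ball _ hr]; simp
    refine continuousWithinAt_const.closure_le hcl
      (Complex.continuous_re.continuousAt.comp hdiff.continuousAt).continuousWithinAt
      (fun z hz => (hgood_re z (hs z (by simpa using hz))).le)
  obtain ⟨hQ0, hQarg⟩ := hQ z₀ hz₀mem
  have hatan := Real.arctan_lt_pi_div_two (β / k)
  by_cases h0 : q z₀ = 0
  · obtain ⟨h1, h2⟩ := mul_deriv_nonpos_of_re_nonneg hz₀ hdiff.hasDerivAt
      (fun z hz => (hgood_re z (hs z hz)).le) h0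
    rw [h0, zero_add] at hQ0 hQarg
    have h3 : arg (z₀ * deriv q z₀ / k) = π := by
      rw [arg_eq_pi_iff]
      have him : (z₀ * deriv q z₀ / k).im = 0 := by rw [div_ofReal_im, h1, zero_div]
      refine ⟨lt_of_le_of_ne ?_ fun h => hQ0 (Complex.ext h him), him⟩
      rw [div_ofReal_re]
      exact div_nonpos_of_nonpos_of_nonneg h2 hk.le
    rw [h3, abs_of_pos hπ] at hQarg
    linarith
  · have hslit : q z₀ ∈ slitPlane := by
      rw [mem_slitPlane_iff_arg]
      have := abs_arg_le_pi_div_two_iff.2 hre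
      exact ⟨fun h => by rw [h, abs_of_pos hπ] at this; linarith, h0⟩
    have hge : π * β / 2 ≤ |arg (q z₀)| := not_lt.1 fun h => hz₀K.2 ⟨h0, h⟩
    have hfin : ∀ σ : ℝ, |σ| = 1 → π * β / 2 ≤ σ * arg (q z₀) →
        ∃ m : ℝ, β ≤ σ * m ∧ arg (q z₀ + z₀ * deriv q z₀ / k) =
          arg (q z₀) + Real.arctan (m / k) := fun σ hσ hσarg => by
      obtain ⟨m, hm, hmd⟩ :=
        exists_mul_deriv_eq_of_le_arg hβ hβ1 hσ hq hq0 hz₀ hz₀1 hs hslit hσarg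
      refine ⟨m, hm, ?_⟩
      rw [hmd, ← arg_mul_one_add_mul_I h0 hre]
      congr 1
      push_cast
      ring
    rcases le_abs.1 hge with h | h
    · obtain ⟨m, hm, he⟩ := hfin 1 (by simp) (by linarith)
      have hmono : Real.arctan (β / k) ≤ Real.arctan (m / k) := by
        apply Real.arctan_mono
        gcongr
        linarith
      rw [he] at hQarg
      linarith [le_abs_self (arg (q z₀) + Real.arctan (m / k))]
    · obtain ⟨m, hm, he⟩ := hfin (-1) (by simp) (by linarith)
      have hmono : Real.arctan (β / k) ≤ Real.arctan (-m / k) := by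
        apply Real.arctan_mono
        gcongr
        linarith
      rw [neg_div, Real.arctan_neg] at hmono
      rw [he] at hQarg
      linarith [neg_abs_le (arg (q z₀) + Real.arctan (m / k))]

open Metric in
/-- A holomorphic function on the disc whose principal argument (with
`arg 0 = 0`) stays below `π` and which is nonzero at the origin has no zeros. -/
lemma ne_zero_of_abs_arg_lt_pi {g : ℂ → ℂ} (hg : DifferentiableOn ℂ g (ball 0 1)) (hg0 : g 0 ≠ 0)
    (h : ∀ z ∈ ball (0 : ℂ) 1, |arg (g z)| < π) : ∀ z ∈ ball (0 : ℂ) 1, g z ≠ 0 := by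
  intro z hz hgz
  rcases (hg.analyticOnNhd isOpen_ball).is_constant_or_isOpen
    (convex_ball (0 : ℂ) 1).isPreconnected with ⟨w, hw⟩ | hopen
  · exact hg0 (by rw [hw 0 (by simp), ← hw z hz, hgz])
  · have hO := hopen _ subset_rfl isOpen_ball
    obtain ⟨ε, hε, hsub⟩ := Metric.isOpen_iff.1 hO 0 ⟨z, hz, hgz⟩
    obtain ⟨w, hw, hgw⟩ := hsub (show (((-(ε / 2) : ℝ)) : ℂ) ∈ ball (0 : ℂ) ε by
      rw [mem_ball_zero_iff, Complex.norm_real, Real.norm_eq_abs, abs_neg, abs_of_pos (by linarith)]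
      linarith)
    have := h w hw
    rw [hgw, arg_ofReal_of_neg (by linarith), abs_of_pos Real.pi_pos] at this
    exact lt_irrefl _ this

lemma abs_arg_div_le (z w : ℂ) : |arg (z / w)| ≤ |arg z| + |arg w| := by
  by_cases hz : z = 0
  · simp [hz]
  by_cases hw : w = 0
  · simp [hw]
  by_cases hlt : |arg z| + |arg w| < π
  · have hle := abs_sub (arg z) (arg w)
    have h2 := abs_lt.1 (hle.trans_lt hlt)
    have hwpi : arg w ≠ π := fun h => by
      rw [h, abs_of_pos Real.pi_pos] at hlt
      linarith [abs_nonneg (arg z)]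
    have hinv : arg w⁻¹ = -arg w := by rw [arg_inv, if_neg hwpi]
    rw [div_eq_mul_inv, arg_mul hz (inv_ne_zero hw), hinv, ← sub_eq_add_neg]
    · exact hle
    · rw [hinv]
      constructor <;> linarith [h2.1, h2.2]
  · exact (abs_arg_le_pi _).trans (not_lt.1 hlt)

open Metric Topology in
/-- One integration step: if `deriv g = c z ^ s u` on the unit disc, `g` vanishes to order `s + 1`
at the origin, and `u` takes values in a sector, then `g` is `c / (s + 1) * z ^ (s + 1)` times a
function with values in a smaller sector. -/
lemma exists_eq_mul_pow_mul_of_deriv_eq {g u : ℂ → ℂ} {s : ℕ} {c β : ℝ} (hc : 0 < c) (hβ : 0 < β)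
    (hβ1 : β ≤ 1) (hg : DifferentiableOn ℂ g (ball 0 1))
    (h0 : ∀ i < s + 1, iteratedDeriv i g 0 = 0) (hu : DifferentiableOn ℂ u (ball 0 1))
    (hu0 : u 0 = 1) (hgu : ∀ z ∈ ball (0 : ℂ) 1, deriv g z = c * z ^ s * u z)
    (harg : ∀ z ∈ ball (0 : ℂ) 1, u z ≠ 0 ∧
      |arg (u z)| < π * β / 2 + Real.arctan (β / (s + 1 : ℕ))) :
    ∃ q : ℂ → ℂ, DifferentiableOn ℂ q (ball 0 1) ∧ q 0 = 1 ∧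
      (∀ z ∈ ball (0 : ℂ) 1, g z = (c / (s + 1 : ℕ) : ℝ) * z ^ (s + 1) * q z) ∧
      ∀ z ∈ ball (0 : ℂ) 1, q z ≠ 0 ∧ |arg (q z)| < π * β / 2 := by
  obtain ⟨Q, hQ, hgQ⟩ := exists_eq_pow_mul_of_iteratedDeriv_eq_zero hg h0
  set k : ℝ := ((s + 1 : ℕ) : ℝ) with hk
  have hkpos : 0 < k := by positivity
  have hk0 : (k : ℂ) ≠ 0 := by exact_mod_cast hkpos.ne'
  have hc0 : (c : ℂ) ≠ 0 := by exact_mod_cast hc.ne'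
  have hQd : ∀ z ∈ ball (0 : ℂ) 1, DifferentiableAt ℂ Q z := fun z hz =>
    (hQ z hz).differentiableAt (isOpen_ball.mem_nhds hz)
  have hne : ∀ z ∈ ball (0 : ℂ) 1, z ≠ 0 → k * Q z + z * deriv Q z = c * u z := by
    intro z hz hz0
    have h1 : deriv g z = k * z ^ s * Q z + z ^ (s + 1) * deriv Q z := by
      have he : g =ᶠ[𝓝 z] fun w => w ^ (s + 1) * Q w := by
        filter_upwards [isOpen_ball.mem_nhds hz] with w hw using hgQ w hw
      rw [he.deriv_eq]
      rw [((hasDerivAt_pow (s + 1) z).fun_mul (hQd z hz).hasDerivAt).deriv]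
      simp [hk]
    rw [hgu z hz] at h1
    have hzs := pow_ne_zero s hz0
    apply mul_left_cancel₀ hzs
    linear_combination -h1
  have hall : ∀ z ∈ ball (0 : ℂ) 1, k * Q z + z * deriv Q z = c * u z := by
    intro z hz
    have hQ' : ContinuousOn (deriv Q) (ball 0 1) :=
      (hQ.deriv isOpen_ball).continuousOn
    by_cases hz0 : z = 0
    · subst hz0
      have hL : ContinuousAt (fun z => k * Q z + z * deriv Q z) 0 := by
        have h1 := (hQd 0 hz).continuousAt
        have h2 := hQ'.continuousAt (isOpen_ball.mem_nhds hz)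
        fun_prop
      have hR : ContinuousAt (fun z => c * u z) 0 :=
        continuousAt_const.mul (hu.continuousOn.continuousAt (isOpen_ball.mem_nhds hz))
      refine tendsto_nhds_unique (l := 𝓝[≠] (0 : ℂ)) (hL.tendsto.mono_left nhdsWithin_le_nhds)
        ((hR.tendsto.mono_left nhdsWithin_le_nhds).congr' ?_)
      filter_upwards [self_mem_nhdsWithin,
        nhdsWithin_le_nhds (isOpen_ball.mem_nhds hz)] with w hw hw1
      exact (hne w hw1 hw).symm
    · exact hne z hz hz0
  have hQ0 : Q 0 = c / k := by
    have := hall 0 (by simp)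
    rw [zero_mul, add_zero, hu0, mul_one] at this
    rw [eq_div_iff hk0, mul_comm, this]
  have hqu : ∀ z ∈ ball (0 : ℂ) 1,
      k / c * Q z + z * deriv (fun w => (k / c : ℂ) * Q w) z / k = u z := fun z hz => by
    rw [deriv_const_mul _ (hQd z hz)]
    field_simp
    exact hall z hz
  have hqd : DifferentiableOn ℂ (fun z => (k / c : ℂ) * Q z) (ball 0 1) := hQ.const_mul _
  have hq0 : (k / c : ℂ) * Q 0 = 1 := by rw [hQ0]; field_simp
  refine ⟨fun z => (k / c : ℂ) * Q z, hqd, hq0, fun z hz => ?_, ?_⟩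
  · rw [hgQ z hz]
    push_cast
    field_simp
  · refine abs_arg_lt_of_abs_arg_add_mul_deriv_lt hkpos hβ hβ1 hqd hq0 fun z hz => ?_
    rw [hqu z hz]
    exact harg z hz


/-- Let `p ≥ 2`, `f(z) = z^p + ⋯` analytic in the unit disc,
`α₀ ∈ (0, 3/2]`, and `α` the positive sequence with `α 0 = α₀` and
`α k + (2/π)·arctan(α k / k) = α (k-1)` for `1 ≤ k ≤ p`.
If `|arg f^{(p)}(z)| < π·α₀/2` on the disc, then for every `s ∈ {2,…,p}`,
`|arg(z·f^{(p-s+1)}(z)/f^{(p-s)}(z))| < (π/2)(α s + α (s-1))` on the punctured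
disc. -/
theorem stmt_11 (p : ℕ) (hp : 2 ≤ p) (f : ℂ → ℂ)
    (hf : AnalyticOnNhd ℂ f {z : ℂ | ‖z‖ < 1})
    (hf0 : ∀ k < p, iteratedDeriv k f 0 = 0)
    (hfp : iteratedDeriv p f 0 = (p.factorial : ℂ))
    (α₀ : ℝ) (hα₀ : α₀ ∈ Set.Ioc (0 : ℝ) (3 / 2))
    (α : ℕ → ℝ) (hαpos : ∀ k ≤ p, 0 < α k) (hα0 : α 0 = α₀)
    (hrec : ∀ k, 1 ≤ k → k ≤ p →
      α k + (2 / Real.pi) * Real.arctan (α k / k) = α (k - 1))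
    (harg : ∀ z : ℂ, ‖z‖ < 1 →
      |Complex.arg (iteratedDeriv p f z)| < Real.pi * α₀ / 2) :
    ∀ s, 2 ≤ s → s ≤ p → ∀ z : ℂ, ‖z‖ < 1 → z ≠ 0 →
      |Complex.arg (z * iteratedDeriv (p - s + 1) f z / iteratedDeriv (p - s) f z)| <
        (Real.pi / 2) * (α s + α (s - 1)) := by
  have hπ := Real.pi_pos
  have hball : {z : ℂ | ‖z‖ < 1} = Metric.ball (0 : ℂ) 1 := by ext; simp
  have hfd : ∀ n, DifferentiableOn ℂ (iteratedDeriv n f) (Metric.ball 0 1) := fun n => by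
    rw [← hball, iteratedDeriv_eq_iterate]
    exact (hf.iterated_deriv n).differentiableOn
  have hstep : ∀ k, 1 ≤ k → k ≤ p → α k < α (k - 1) := fun k h1 h2 => by
    rw [← hrec k h1 h2]
    have h3 : 0 < α k / k := div_pos (hαpos k h2) (by exact_mod_cast h1)
    have := mul_pos (div_pos two_pos hπ) (Real.arctan_pos.2 h3)
    linarith
  have hα1 : α 1 ≤ 1 := by
    by_contra! h
    have h1 := hrec 1 le_rfl (by omega)
    rw [Nat.cast_one, div_one, Nat.sub_self, hα0] at h1
    have h2 : π / 4 < Real.arctan (α 1) := by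
      rw [← Real.arctan_one]
      exact Real.arctan_strictMono h
    have h3 : 2 / π * (π / 4) < 2 / π * Real.arctan (α 1) :=
      mul_lt_mul_of_pos_left h2 (by positivity)
    have h4 : 2 / π * (π / 4) = 1 / 2 := by field_simp; norm_num
    linarith [hα₀.2]
  have hαle : ∀ k, k + 1 ≤ p → α (k + 1) ≤ 1 := by
    intro k
    induction k with
    | zero => exact fun _ => hα1
    | succ k ih =>
      intro hk
      have := hstep (k + 1 + 1) (by omega) hk
      rw [Nat.add_sub_cancel] at this
      linarith [ih (by omega)]
  have main : ∀ s ≤ p, ∃ (c : ℝ) (q : ℂ → ℂ), 0 < c ∧ DifferentiableOn ℂ q (Metric.ball 0 1) ∧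
      q 0 = 1 ∧
      (∀ z ∈ Metric.ball (0 : ℂ) 1, iteratedDeriv (p - s) f z = c * z ^ s * q z) ∧
      ∀ z ∈ Metric.ball (0 : ℂ) 1, q z ≠ 0 ∧ |arg (q z)| < π * α s / 2 := by
    intro s
    induction s with
    | zero =>
      intro _
      have hfac : (0 : ℝ) < p.factorial := by exact_mod_cast p.factorial_pos
      have hfac0 : ((p.factorial : ℝ) : ℂ) ≠ 0 := by exact_mod_cast hfac.ne'
      have hq : ∀ z : ℂ, iteratedDeriv p f z / (p.factorial : ℝ) =
          ((p.factorial : ℝ)⁻¹ : ℝ) * iteratedDeriv p f z := fun z => by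
        push_cast; ring
      have hnz := ne_zero_of_abs_arg_lt_pi (hfd p)
        (by rw [hfp]; exact_mod_cast p.factorial_ne_zero)
        (fun z hz => (harg z (by simpa using hz)).trans_le (by nlinarith [hα₀.2]))
      refine ⟨p.factorial, fun z => iteratedDeriv p f z / (p.factorial : ℝ), hfac,
        (hfd p).div_const _, ?_, fun z hz => ?_, fun z hz => ⟨div_ne_zero (hnz z hz) hfac0, ?_⟩⟩
      · simp only [hfp]
        push_cast at hfac0 ⊢
        exact div_self hfac0
      · simp only [Nat.sub_zero]
        field_simp
      · beta_reduce
        rw [hq, arg_real_mul _ (inv_pos.2 hfac), hα0]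
        exact harg z (by simpa using hz)
    | succ s ih =>
      intro hs
      obtain ⟨c, u, hc, hu, hu0, hgu, hua⟩ := ih (by omega)
      have hsub : p - s = p - (s + 1) + 1 := by omega
      have hr := hrec (s + 1) (by omega) hs
      rw [Nat.add_sub_cancel] at hr
      have hang : π * α s / 2 = π * α (s + 1) / 2 + Real.arctan (α (s + 1) / (s + 1 : ℕ)) := by
        rw [← hr]
        field_simp
      obtain ⟨q, h1, h2, h3, h4⟩ := exists_eq_mul_pow_mul_of_deriv_eq hc (hαpos (s + 1) hs)
        (hαle s hs) (hfd (p - (s + 1)))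
        (fun i (hi : i < s + 1) => by
          have := hf0 (i + (p - (s + 1))) (by omega)
          rw [iteratedDeriv_eq_iterate, Function.iterate_add_apply] at this
          rw [iteratedDeriv_eq_iterate, iteratedDeriv_eq_iterate]
          exact this)
        hu hu0
        (fun z hz => by rw [← iteratedDeriv_succ, ← hsub]; exact hgu z hz)
        (fun z hz => by rw [← hang]; exact hua z hz)
      exact ⟨_, q, by positivity, h1, h2, h3, h4⟩
  intro s hs2 hsp z hz hz0
  obtain ⟨c, q, hc, -, -, hq, hqa⟩ := main s hsp
  obtain ⟨e, u, he, -, -, hu, hua⟩ := main (s - 1) (by omega)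
  have hzb : z ∈ Metric.ball (0 : ℂ) 1 := by simpa using hz
  have hsub : p - s + 1 = p - (s - 1) := by omega
  have hc0 : (c : ℂ) ≠ 0 := by exact_mod_cast hc.ne'
  have hquot : z * iteratedDeriv (p - s + 1) f z / iteratedDeriv (p - s) f z =
      (e / c : ℝ) * (u z / q z) := by
    have hzs : z ^ s = z * z ^ (s - 1) := by rw [← pow_succ']; congr 1; omega
    have hqz := (hqa z hzb).1
    rw [hsub, hu z hzb, hq z hzb, hzs]
    push_cast
    field_simp
  rw [hquot, arg_real_mul _ (div_pos he hc)]
  refine (abs_arg_div_le _ _).trans_lt ?_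
  linarith [(hqa z hzb).2, (hua z hzb).2]
end

section
/- Let p ≥ 2 be an integer and let f(z) = z^p + ∑_{n=p+1}^∞ a_n z^n be analytic in the open unit disc 𝔻. Let α₀ ∈ (0, 3/2] and let α : {0,1,…,p} → ℝ be the sequence of positive reals with α_0 = α₀ and α_k + (2/π)·arctan(α_k / k) = α_{k-1} for k = 1, …, p. Assume |arg f^{(p)}(z)| < π·α₀/2 for all z ∈ 𝔻, and assume there exists σ ∈ {2, …, p} with α_σ + α_{σ-1} ≤ 1. Then |arg( z·f'(z)/f(z) )| < π(α_{p-1} + α_p)/2 ≤ π/2 for all z ∈ 𝔻, z ≠ 0, i.e. f is p-valently strongly starlike of order α_{p-1} + α_p. -/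
open Complex Real

open Metric Filter Topology

/-- A real function vanishing at `0` and nonnegative to the right of `0` has a nonnegative
derivative there. -/
lemma HasDerivAt.nonneg_of_eventually_nonneg_right {φ : ℝ → ℝ} {d : ℝ} (hφ : HasDerivAt φ d 0)
    (h0 : φ 0 = 0) (hnn : ∀ᶠ s in 𝓝[>] (0 : ℝ), 0 ≤ φ s) : 0 ≤ d := by
  have h := (hasDerivWithinAt_iff_tendsto_slope' (s := Set.Ioi (0 : ℝ)) (by simp)).1
    hφ.hasDerivWithinAt
  refine ge_of_tendsto h ?_
  filter_upwards [hnn, self_mem_nhdsWithin] with s hs hs0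
  rw [slope_def_field, h0, sub_zero, sub_zero]
  exact div_nonneg hs (le_of_lt hs0)

/-- Carathéodory's estimate for functions with positive real part on a disc. -/
lemma normSq_mul_le_of_re_pos {G : ℂ → ℂ} {R : ℝ}
    (hd : DifferentiableOn ℂ G (ball 0 R)) (hpos : ∀ z ∈ ball (0 : ℂ) R, 0 < (G z).re)
    (h0 : G 0 = 1) {z : ℂ} (hz : z ∈ ball (0 : ℂ) R) {t : ℝ} (ht : ‖z‖ / R ≤ t) :
    (1 + ((G z).re ^ 2 + (G z).im ^ 2)) * (1 - t ^ 2) ≤ 2 * (G z).re * (1 + t ^ 2) := by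
  have hR : 0 < R := nonempty_ball.1 ⟨z, hz⟩
  have hne : ∀ w ∈ ball (0 : ℂ) R, G w + 1 ≠ 0 := fun w hw h => by
    have := congrArg Complex.re h
    have := hpos w hw
    simp at *
    linarith
  have hnorm : ∀ w ∈ ball (0 : ℂ) R, ‖(G w - 1) / (G w + 1)‖ ≤ 1 := fun w hw => by
    rw [norm_div, div_le_one (norm_pos_iff.2 (hne w hw))]
    refine le_of_sq_le_sq ?_ (norm_nonneg _)
    rw [Complex.sq_norm, Complex.sq_norm, Complex.normSq_apply, Complex.normSq_apply]
    have := hpos w hw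
    simp
    nlinarith
  have hS := Complex.dist_le_div_mul_dist_of_mapsTo_ball (f := fun w => (G w - 1) / (G w + 1))
    (c := 0) (R₁ := R) (R₂ := 1) (z := z)
    ((hd.sub_const 1).div (hd.add_const 1) hne)
    (fun w hw => by simpa [h0] using hnorm w hw) hz
  simp only [h0, sub_self, zero_div, dist_zero_right, norm_div] at hS
  have hle : ‖G z - 1‖ ≤ t * ‖G z + 1‖ := by
    rw [div_le_iff₀ (norm_pos_iff.2 (hne z hz))] at hS
    refine hS.trans (mul_le_mul_of_nonneg_right ?_ (norm_nonneg _))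
    rwa [one_div, inv_mul_eq_div]
  have hsq := pow_le_pow_left₀ (norm_nonneg _) hle 2
  rw [mul_pow, Complex.sq_norm, Complex.sq_norm, Complex.normSq_apply, Complex.normSq_apply] at hsq
  simp at hsq
  nlinarith

/-- If `G` has positive real part on a disc, `G 0 = 1`, and `G z₀` is purely imaginary at a
boundary point `z₀`, then `z₀ * G' z₀` is real and negative, with an explicit upper bound. -/
lemma im_eq_zero_and_re_le_of_re_pos {G : ℂ → ℂ} {z₀ G' : ℂ} (hz₀ : z₀ ≠ 0)
    (hd : DifferentiableOn ℂ G (ball 0 ‖z₀‖)) (hpos : ∀ z ∈ ball (0 : ℂ) ‖z₀‖, 0 < (G z).re)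
    (h0 : G 0 = 1) (hG : HasDerivAt G G' z₀) (hre : (G z₀).re = 0) :
    (z₀ * G').im = 0 ∧ (z₀ * G').re ≤ -(1 + (G z₀).im ^ 2) / 2 := by
  have hnz : 0 < ‖z₀‖ := norm_pos_iff.2 hz₀
  have hpath : ∀ d : ℂ, HasDerivAt (fun s : ℝ => G (z₀ * (1 + s * d))) (z₀ * G' * d) 0 := by
    intro d
    have h1 : HasDerivAt (fun s : ℝ => z₀ * (1 + s * d)) (z₀ * d) 0 := by
      have := (((hasDerivAt_id (0 : ℝ)).ofReal_comp.mul_const d).const_add 1).const_mul z₀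
      simpa using this
    have h2 : HasDerivAt G G' (z₀ * (1 + (0 : ℝ) * d)) := by simpa using hG
    rw [show z₀ * G' * d = G' * (z₀ * d) by ring]
    exact h2.comp (0 : ℝ) h1
  have hpathre : ∀ d : ℂ,
      HasDerivAt (fun s : ℝ => (G (z₀ * (1 + s * d))).re) (z₀ * G' * d).re 0 := fun d =>
    Complex.reCLM.hasFDerivAt.comp_hasDerivAt (0 : ℝ) (hpath d)
  have hpathim : ∀ d : ℂ,
      HasDerivAt (fun s : ℝ => (G (z₀ * (1 + s * d))).im) (z₀ * G' * d).im 0 := fun d =>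
    Complex.imCLM.hasFDerivAt.comp_hasDerivAt (0 : ℝ) (hpath d)
  have hdir : ∀ d : ℂ, d.re < 0 → 0 ≤ (z₀ * G' * d).re := by
    intro d hdre
    refine (hpathre d).nonneg_of_eventually_nonneg_right (by simpa using hre) ?_
    have hd0 : 0 < Complex.normSq d := Complex.normSq_pos.2 (by rintro rfl; simp at hdre)
    have hε : 0 < -2 * d.re / Complex.normSq d := div_pos (by linarith) hd0
    filter_upwards [Ioo_mem_nhdsGT hε] with s hs
    refine (hpos _ ?_).le
    rw [mem_ball_zero_iff, norm_mul]
    refine mul_lt_of_lt_one_right hnz ?_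
    have h2 := (lt_div_iff₀ hd0).1 hs.2
    refine lt_of_pow_lt_pow_left₀ 2 zero_le_one ?_
    rw [Complex.sq_norm, Complex.normSq_apply]
    rw [Complex.normSq_apply] at h2
    simp
    nlinarith [mul_lt_mul_of_pos_left h2 hs.1]
  have him : ∀ ε > 0, |(z₀ * G').im| ≤ -(z₀ * G').re * ε := by
    intro ε hε
    have h1 := hdir (-ε + I) (by simpa using hε)
    have h2 := hdir (-ε - I) (by simpa using hε)
    rw [Complex.mul_re] at h1 h2
    simp only [add_re, neg_re, ofReal_re, I_re, add_im, neg_im, ofReal_im, I_im, sub_re,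
      sub_im] at h1 h2
    rw [abs_le]
    constructor <;> linarith
  constructor
  · have h1 := him 1 one_pos
    by_contra hne
    have hpos' : 0 < |(z₀ * G').im| := abs_pos.2 hne
    have h2 := him (1 / 2) (by norm_num)
    have hc : 0 < -(z₀ * G').re := by linarith
    have h3 := him (|(z₀ * G').im| / (2 * -(z₀ * G').re)) (by positivity)
    rw [show ∀ m c : ℝ, c * (m / (2 * c)) = c / c * (m / 2) by intros; ring, div_self hc.ne'] at h3
    linarith
  · have hx := hpathre (-1)
    have hy := hpathim (-1)
    have hq : HasDerivAt (fun s : ℝ => (1 - s) ^ 2) (-2) 0 := by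
      have := ((hasDerivAt_id (0 : ℝ)).const_sub 1).fun_pow 2
      simpa using this
    have h := ((hx.const_mul 2).mul (hq.const_add 1)).sub
      ((((hx.pow 2).add (hy.pow 2)).const_add 1).mul (hq.const_sub 1))
    have := h.nonneg_of_eventually_nonneg_right (by simp [hre]) (by
      filter_upwards [Ioo_mem_nhdsGT one_pos] with s hs
      have hn : ‖z₀ * (1 + s * (-1 : ℂ))‖ = ‖z₀‖ * (1 - s) := by
        rw [norm_mul, show (1 + s * (-1 : ℂ)) = ((1 - s : ℝ) : ℂ) by push_cast; ring,
          Complex.norm_real, Real.norm_of_nonneg (by linarith [hs.2])]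
      have hmem : z₀ * (1 + s * (-1 : ℂ)) ∈ ball (0 : ℂ) ‖z₀‖ := by
        rw [mem_ball_zero_iff, hn]
        exact mul_lt_of_lt_one_right hnz (by linarith [hs.1])
      have := normSq_mul_le_of_re_pos hd hpos h0 hmem (t := 1 - s)
        (by rw [hn, mul_div_cancel_left₀ _ hnz.ne'])
      simp only [Pi.sub_apply, Pi.mul_apply, Pi.add_apply, Pi.pow_apply]
      linarith)
    simp [hre] at this
    rw [Complex.mul_re]
    linarith

lemma arg_one_add_ofReal_mul_I (t : ℝ) : Complex.arg (1 + t * I) = Real.arctan t := by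
  have hre : (1 + t * I : ℂ).re = 1 := by simp
  have h := abs_lt.1 (Complex.abs_arg_lt_pi_div_two_iff.2 (Or.inl (hre ▸ one_pos)))
  rw [← Real.arctan_tan h.1 h.2, Complex.tan_arg]
  simp

/-- Local form of Nunokawa's lemma: at a boundary point where `q` first leaves the sector
`|arg w| < π * α / 2`, the quantity `q + z * q' / k` lies outside the sector
`|arg w| < π * α / 2 + arctan (α / k)`. -/
lemma nunokawa_boundary {q : ℂ → ℂ} {z₀ q' : ℂ} {α k : ℝ} (hα : 0 < α) (hα1 : α ≤ 1)
    (hk : 0 < k) (hz₀ : z₀ ≠ 0) (hd : DifferentiableOn ℂ q (ball 0 ‖z₀‖)) (h0 : q 0 = 1)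
    (hsec : ∀ z ∈ ball (0 : ℂ) ‖z₀‖, q z ∈ slitPlane ∧ |Complex.arg (q z)| < Real.pi * α / 2)
    (hq : HasDerivAt q q' z₀)
    (hout : ¬ (q z₀ ∈ slitPlane ∧ |Complex.arg (q z₀)| < Real.pi * α / 2)) :
    ¬ (q z₀ + z₀ * q' / k ∈ slitPlane ∧
      |Complex.arg (q z₀ + z₀ * q' / k)| < Real.pi * α / 2 + Real.arctan (α / k)) := by
  have hpi := Real.pi_pos
  have hαpi : Real.pi * α / 2 ≤ Real.pi / 2 := by nlinarith
  have hrepos : ∀ z ∈ ball (0 : ℂ) ‖z₀‖, 0 < (q z).re := fun z hz =>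
    (Complex.abs_arg_lt_pi_div_two_iff.1 ((hsec z hz).2.trans_le hαpi)).resolve_right
      (Complex.slitPlane_ne_zero (hsec z hz).1)
  have hnb : (𝓝[ball (0 : ℂ) ‖z₀‖] z₀).NeBot := by
    rw [← mem_closure_iff_nhdsWithin_neBot, closure_ball _ (norm_ne_zero_iff.2 hz₀)]
    simp
  have hcont : Tendsto q (𝓝[ball (0 : ℂ) ‖z₀‖] z₀) (𝓝 (q z₀)) :=
    hq.continuousAt.mono_left inf_le_left
  have hre : 0 ≤ (q z₀).re := by
    refine ge_of_tendsto ((Complex.continuous_re.tendsto _).comp hcont) ?_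
    filter_upwards [self_mem_nhdsWithin] with z hz using (hrepos z hz).le
  rintro ⟨hslit, harg⟩
  by_cases hqz : q z₀ = 0
  · have hA := im_eq_zero_and_re_le_of_re_pos hz₀ hd hrepos h0 hq (by simp [hqz])
    rw [hqz, zero_add, Complex.mem_slitPlane_iff, Complex.div_ofReal_re,
      Complex.div_ofReal_im, hA.1] at hslit
    have h1 : (z₀ * q').re < 0 := by
      have := sq_nonneg (q z₀).im
      linarith [hA.2]
    have := div_neg_of_neg_of_pos h1 hk
    rcases hslit with h | h
    · linarith
    · simp at h
  have hqslit : q z₀ ∈ slitPlane := by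
    rw [Complex.mem_slitPlane_iff]
    by_contra! h
    exact hqz (Complex.ext (le_antisymm h.1 hre) h.2)
  have hargle : |Complex.arg (q z₀)| ≤ Real.pi * α / 2 := by
    refine le_of_tendsto (((Complex.continuousAt_arg hqslit).tendsto.comp hcont).abs) ?_
    filter_upwards [self_mem_nhdsWithin] with z hz using (hsec z hz).2.le
  have hargeq : |Complex.arg (q z₀)| = Real.pi * α / 2 :=
    hargle.antisymm (not_lt.1 fun h => hout ⟨hqslit, h⟩)
  set G : ℂ → ℂ := fun z => q z ^ (((1 / α : ℝ)) : ℂ) with hGdef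
  have hGpos : ∀ z ∈ ball (0 : ℂ) ‖z₀‖, 0 < (G z).re := by
    intro z hz
    have h := hsec z hz
    rw [hGdef, Complex.cpow_ofReal_re]
    refine mul_pos (Real.rpow_pos_of_pos (norm_pos_iff.2 (Complex.slitPlane_ne_zero h.1)) _)
      (Real.cos_pos_of_mem_Ioo ?_)
    have h2 := abs_lt.1 h.2
    rw [mul_one_div]
    constructor
    · rw [lt_div_iff₀ hα]; linarith
    · rw [div_lt_iff₀ hα]; linarith
  have hGd : DifferentiableOn ℂ G (ball 0 ‖z₀‖) := fun z hz =>
    (hd z hz).cpow_const (hsec z hz).1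
  have hG := hq.cpow_const (c := ((1 / α : ℝ) : ℂ)) hqslit
  have hGre : (G z₀).re = 0 := by
    rw [hGdef, Complex.cpow_ofReal_re, mul_one_div, ← Real.cos_abs, abs_div, hargeq,
      abs_of_pos hα, show Real.pi * α / 2 / α = Real.pi / 2 by field_simp, Real.cos_pi_div_two,
      mul_zero]
  obtain ⟨hA1, hA2⟩ := im_eq_zero_and_re_le_of_re_pos hz₀ hGd hGpos (by simp [hGdef, h0]) hG hGre
  have hGim : (G z₀).im = ‖q z₀‖ ^ (1 / α) * Real.sin (Complex.arg (q z₀) * (1 / α)) := by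
    rw [hGdef, Complex.cpow_ofReal_im]
  set a : ℝ := (G z₀).im with ha
  have hGa : G z₀ = a * I := by
    apply Complex.ext <;> simp [hGre, ha]
  set s : ℝ := -(z₀ * ((((1 / α : ℝ)) : ℂ) * q z₀ ^ ((((1 / α : ℝ)) : ℂ) - 1) * q')).re with hs
  have hsG : z₀ * ((((1 / α : ℝ)) : ℂ) * q z₀ ^ ((((1 / α : ℝ)) : ℂ) - 1) * q') = -(s : ℂ) := by
    apply Complex.ext
    · simp only [hs, Complex.neg_re, Complex.ofReal_re, neg_neg]
    · rw [hA1]; simp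
  have hs_ge : (1 + a ^ 2) / 2 ≤ s := by linarith
  have ha0 : a ≠ 0 := by
    intro h
    have : G z₀ = 0 := by rw [hGa, h]; simp
    rw [hGdef] at this
    exact hqz ((Complex.cpow_eq_zero_iff _ _).1 this).1
  have hlog : z₀ * q' = q z₀ * ((α * s / a : ℝ) * I) := by
    rw [Complex.cpow_sub _ _ hqz, Complex.cpow_one] at hsG
    change z₀ * (_ * (G z₀ / _) * q') = _ at hsG
    rw [hGa] at hsG
    have ha0' : (a : ℂ) ≠ 0 := by exact_mod_cast ha0
    have hα' : (α : ℂ) ≠ 0 := by exact_mod_cast hα.ne'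
    push_cast at hsG ⊢
    field_simp at hsG ⊢
    linear_combination (-I) * hsG + (z₀ * a * q') * Complex.I_sq
  set y : ℝ := α * s / a / k with hy
  have hh : q z₀ + z₀ * q' / k = q z₀ * (1 + y * I) := by
    rw [hlog, hy]; push_cast; ring
  have hatan := Real.arctan_lt_pi_div_two y
  have hatan' := Real.neg_pi_div_two_lt_arctan y
  have hargh : Complex.arg (q z₀ + z₀ * q' / k) = Complex.arg (q z₀) + Real.arctan y := by
    rw [hh, ← arg_one_add_ofReal_mul_I]
    refine Complex.arg_mul hqz (fun h => ?_) ?_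
    · simpa using congrArg Complex.re h
    · rw [arg_one_add_ofReal_mul_I]
      have := abs_le.1 hargle
      constructor <;> linarith
  have hnpos : 0 < ‖q z₀‖ ^ (1 / α) := Real.rpow_pos_of_pos (norm_pos_iff.2 hqz) _
  rw [hargh] at harg
  rcases abs_choice (Complex.arg (q z₀)) with hc | hc
  · have harg0 : Complex.arg (q z₀) = Real.pi * α / 2 := by rw [← hc, hargeq]
    have hapos : 0 < a := by
      rw [hGim, harg0, show Real.pi * α / 2 * (1 / α) = Real.pi / 2 by field_simp,
        Real.sin_pi_div_two]
      linarith
    have : α / k ≤ y := by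
      rw [hy]
      refine div_le_div_of_nonneg_right ?_ hk.le
      rw [le_div_iff₀ hapos]
      nlinarith [sq_nonneg (a - 1)]
    have h2 := Real.arctan_strictMono.monotone this
    linarith [(abs_lt.1 harg).2]
  · have harg0 : Complex.arg (q z₀) = -(Real.pi * α / 2) := by linarith
    have haneg : a < 0 := by
      rw [hGim, harg0, show -(Real.pi * α / 2) * (1 / α) = -(Real.pi / 2) by field_simp,
        Real.sin_neg, Real.sin_pi_div_two]
      linarith
    have : y ≤ -(α / k) := by
      rw [hy, ← neg_div]
      refine div_le_div_of_nonneg_right ?_ hk.le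
      rw [div_le_iff_of_neg haneg]
      nlinarith [sq_nonneg (a + 1)]
    have h2 := Real.arctan_strictMono.monotone this
    rw [Real.arctan_neg] at h2
    linarith [(abs_lt.1 harg).1]

/-- Nunokawa's lemma in integrated form. -/
lemma abs_arg_lt_of_abs_arg_add_mul_deriv_lt_s12 {q : ℂ → ℂ} {α k : ℝ} (hα : 0 < α) (hα1 : α ≤ 1)
    (hk : 0 < k) (hd : DifferentiableOn ℂ q (ball 0 1)) (h0 : q 0 = 1)
    (hsec : ∀ z ∈ ball (0 : ℂ) 1, q z + z * deriv q z / k ∈ slitPlane ∧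
      |Complex.arg (q z + z * deriv q z / k)| < Real.pi * α / 2 + Real.arctan (α / k))
    {z : ℂ} (hz : z ∈ ball (0 : ℂ) 1) :
    q z ∈ slitPlane ∧ |Complex.arg (q z)| < Real.pi * α / 2 := by
  set S : Set ℂ := {w | w ∈ slitPlane ∧ |Complex.arg w| < Real.pi * α / 2} with hS
  have hSo : IsOpen S := by
    refine isOpen_iff_mem_nhds.2 fun w hw => ?_
    exact Filter.inter_mem (Complex.isOpen_slitPlane.mem_nhds hw.1)
      ((Complex.continuousAt_arg hw.1).abs.eventually_lt_const hw.2)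
  change q z ∈ S
  by_contra hzS
  have hsub : closedBall (0 : ℂ) ‖z‖ ⊆ ball 0 1 :=
    closedBall_subset_ball (mem_ball_zero_iff.1 hz)
  have hK : IsCompact (closedBall (0 : ℂ) ‖z‖ ∩ q ⁻¹' Sᶜ) :=
    (isCompact_closedBall _ _).of_isClosed_subset
      ((hd.continuousOn.mono hsub).preimage_isClosed_of_isClosed isClosed_closedBall
        hSo.isClosed_compl) Set.inter_subset_left
  obtain ⟨z₀, ⟨hz₀, hz₀S⟩, hmin⟩ := hK.exists_isMinOn ⟨z, by simp, hzS⟩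
    continuous_norm.continuousOn
  have hz₀1 := hsub hz₀
  refine nunokawa_boundary hα hα1 hk (z₀ := z₀) ?_ (hd.mono (ball_subset_ball
    (mem_ball_zero_iff.1 hz₀1).le)) h0 (fun w hw => ?_)
    (hd.differentiableAt (isOpen_ball.mem_nhds hz₀1)).hasDerivAt hz₀S (hsec z₀ hz₀1)
  · rintro rfl
    refine hz₀S ?_
    rw [h0]
    exact ⟨Complex.one_mem_slitPlane, by simpa using by positivity⟩
  · by_contra hwS
    rw [mem_ball_zero_iff] at hw
    have h1 : ‖w‖ ≤ ‖z‖ := hw.le.trans (mem_closedBall_zero_iff.1 hz₀)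
    exact absurd (hmin ⟨mem_closedBall_zero_iff.2 h1, hwS⟩) (not_le.2 hw)

/-- A holomorphic function whose first `k` Taylor coefficients at `0` vanish is divisible
by `z ^ k`. -/
lemma exists_differentiableOn_eq_pow_mul {F : ℂ → ℂ} {R : ℝ} (hR : 0 < R)
    (hF : DifferentiableOn ℂ F (ball 0 R)) {k : ℕ} (h0 : ∀ j < k, iteratedDeriv j F 0 = 0) :
    ∃ q : ℂ → ℂ, DifferentiableOn ℂ q (ball 0 R) ∧ ∀ z, F z = z ^ k * q z := by
  have hFa : AnalyticAt ℂ F 0 := hF.analyticAt (ball_mem_nhds _ hR)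
  obtain ⟨g, hg, hFg⟩ := (natCast_le_analyticOrderAt hFa).1
    ((natCast_le_analyticOrderAt_iff_iteratedDeriv_eq_zero hFa).2 h0)
  simp only [sub_zero, smul_eq_mul] at hFg
  refine ⟨Function.update (fun z => F z / z ^ k) 0 (g 0), fun z hz => ?_, fun z => ?_⟩
  · rcases eq_or_ne z 0 with rfl | hz0
    · refine (hg.differentiableAt.congr_of_eventuallyEq ?_).differentiableWithinAt
      filter_upwards [hFg] with w hw
      rcases eq_or_ne w 0 with rfl | hw0
      · simp
      · rw [Function.update_of_ne hw0, hw, mul_div_cancel_left₀ _ (pow_ne_zero _ hw0)]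
    · have h : DifferentiableAt ℂ (fun z => F z / z ^ k) z :=
        (hF.differentiableAt (isOpen_ball.mem_nhds hz)).div (by fun_prop) (pow_ne_zero _ hz0)
      refine (h.congr_of_eventuallyEq ?_).differentiableWithinAt
      filter_upwards [isOpen_ne.mem_nhds hz0] with w hw
      exact Function.update_of_ne hw _ _
  · rcases eq_or_ne z 0 with rfl | hz0
    · simpa using hFg.self_of_nhds
    · rw [Function.update_of_ne hz0, mul_div_cancel₀ _ (pow_ne_zero _ hz0)]

lemma eq_add_mul_deriv_of_deriv_pow_mul {P Q : ℂ → ℂ} {R : ℝ} {k : ℕ}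
    (hP : DifferentiableOn ℂ P (ball 0 R)) (hQ : DifferentiableOn ℂ Q (ball 0 R))
    (h : ∀ z ∈ ball (0 : ℂ) R, deriv (fun z => z ^ (k + 1) * Q z) z = z ^ k * P z)
    {z : ℂ} (hz : z ∈ ball (0 : ℂ) R) : P z = (k + 1) * Q z + z * deriv Q z := by
  have hne : ∀ w ∈ ball (0 : ℂ) R, w ≠ 0 → P w = (k + 1) * Q w + w * deriv Q w := by
    intro w hw hw0
    have hd := ((hasDerivAt_pow (k + 1) w).fun_mul
      (hQ.differentiableAt (isOpen_ball.mem_nhds hw)).hasDerivAt).deriv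
    rw [h w hw] at hd
    refine mul_left_cancel₀ (pow_ne_zero k hw0) ?_
    rw [hd]
    push_cast
    ring
  have hnhds := isOpen_ball.mem_nhds hz
  have hPc : ContinuousAt P z := (hP.differentiableAt hnhds).continuousAt
  have hQc : ContinuousAt Q z := (hQ.differentiableAt hnhds).continuousAt
  have hQ'c : ContinuousAt (deriv Q) z :=
    ((hQ.deriv isOpen_ball).differentiableAt hnhds).continuousAt
  refine Filter.EventuallyEq.eq_of_nhds (f := P) (g := fun z => (k + 1) * Q z + z * deriv Q z) ?_
  refine (ContinuousAt.eventuallyEq_nhds_iff_eventuallyEq_nhdsNE hPc (by fun_prop)).1 ?_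
  have h0 : ∀ᶠ w in 𝓝[≠] z, w ≠ 0 := by
    rcases eq_or_ne z 0 with rfl | hz0
    · exact self_mem_nhdsWithin
    · exact nhdsWithin_le_nhds (isOpen_ne.mem_nhds hz0)
  filter_upwards [h0, nhdsWithin_le_nhds hnhds] with w hw hwb using hne w hwb hw

/-- By the open mapping theorem, a holomorphic function with `|arg| < π` has no zeros unless it
vanishes identically (note that `Complex.arg 0 = 0`). -/
lemma mem_slitPlane_of_abs_arg_lt {g : ℂ → ℂ} {R c : ℝ} (hc : c ≤ Real.pi)
    (hg : DifferentiableOn ℂ g (ball 0 R)) (h0 : g 0 ≠ 0)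
    (harg : ∀ z ∈ ball (0 : ℂ) R, |Complex.arg (g z)| < c) {z : ℂ} (hz : z ∈ ball (0 : ℂ) R) :
    g z ∈ slitPlane := by
  have hargpi : ∀ w ∈ ball (0 : ℂ) R, Complex.arg (g w) ≠ Real.pi := fun w hw h => by
    have := harg w hw
    rw [h, abs_of_pos Real.pi_pos] at this
    linarith
  refine Complex.mem_slitPlane_iff_arg.2 ⟨hargpi z hz, fun hgz => ?_⟩
  have h0R : (0 : ℂ) ∈ ball (0 : ℂ) R := mem_ball_self (nonempty_ball.1 ⟨z, hz⟩)
  rcases (hg.analyticOnNhd isOpen_ball).is_constant_or_isOpen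
    (convex_ball _ _).isPreconnected with ⟨w, hw⟩ | ho
  · exact h0 ((hw 0 h0R).trans ((hw z hz).symm.trans hgz))
  · have hmem : g '' ball 0 R ∈ 𝓝 (0 : ℂ) :=
      (ho _ subset_rfl isOpen_ball).mem_nhds ⟨z, hz, hgz⟩
    obtain ⟨ε, hε, hsub⟩ := Metric.mem_nhds_iff.1 hmem
    obtain ⟨w, hw, hwe⟩ := hsub (show ((-(ε / 2) : ℝ) : ℂ) ∈ ball (0 : ℂ) ε by
      rw [mem_ball_zero_iff, Complex.norm_real, norm_neg, Real.norm_of_nonneg (by positivity)]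
      linarith)
    exact hargpi w hw (by rw [hwe]; exact Complex.arg_ofReal_of_neg (by linarith))

lemma le_one_of_add_arctan_le {x : ℝ} (h : x + (2 / Real.pi) * Real.arctan x ≤ 3 / 2) :
    x ≤ 1 := by
  by_contra! hx
  have h1 := Real.arctan_strictMono hx
  rw [Real.arctan_one] at h1
  have h2 := mul_lt_mul_of_pos_left h1 (div_pos two_pos Real.pi_pos)
  have h3 : 2 / Real.pi * (Real.pi / 4) = 1 / 2 := by field_simp; norm_num
  linarith

/-- The sector estimates for the normalised derivatives of `f`. -/
lemma exists_normalised_iteratedDeriv {p : ℕ} {f : ℂ → ℂ}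
    (hf : DifferentiableOn ℂ f (ball 0 1)) (hf0 : ∀ k < p, iteratedDeriv k f 0 = 0)
    (hfp : iteratedDeriv p f 0 = (p.factorial : ℂ)) {α : ℕ → ℝ} (hα0 : α 0 ≤ 3 / 2)
    (hαpos : ∀ k ≤ p, 0 < α k) (hα1 : ∀ k, 1 ≤ k → k ≤ p → α k ≤ 1)
    (hrec : ∀ k, 1 ≤ k → k ≤ p →
      α k + (2 / Real.pi) * Real.arctan (α k / k) = α (k - 1))
    (harg : ∀ z ∈ ball (0 : ℂ) 1, |Complex.arg (iteratedDeriv p f z)| < Real.pi * α 0 / 2)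
    {k : ℕ} (hk : k ≤ p) :
    ∃ q : ℂ → ℂ, DifferentiableOn ℂ q (ball 0 1) ∧ q 0 = 1 ∧
      (∀ z ∈ ball (0 : ℂ) 1,
        iteratedDeriv (p - k) f z = (p.factorial / k.factorial : ℝ) * (z ^ k * q z)) ∧
      ∀ z ∈ ball (0 : ℂ) 1, q z ∈ slitPlane ∧ |Complex.arg (q z)| < Real.pi * α k / 2 := by
  have hpi := Real.pi_pos
  have hD : ∀ n, DifferentiableOn ℂ (iteratedDeriv n f) (ball 0 1) := by
    intro n
    induction n with
    | zero => simpa using hf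
    | succ n ih => rw [iteratedDeriv_succ]; exact ih.deriv isOpen_ball
  have hp0 : (p.factorial : ℂ) ≠ 0 := by exact_mod_cast p.factorial_ne_zero
  induction k with
  | zero =>
    have hpos : (0 : ℝ) < (p.factorial : ℝ)⁻¹ := by positivity
    have hargq : ∀ z ∈ ball (0 : ℂ) 1,
        |Complex.arg (((p.factorial : ℝ)⁻¹ : ℝ) * iteratedDeriv p f z)| < Real.pi * α 0 / 2 :=
      fun z hz => by rw [Complex.arg_real_mul _ hpos]; exact harg z hz
    have hq0 : (((p.factorial : ℝ)⁻¹ : ℝ) : ℂ) * iteratedDeriv p f 0 = 1 := by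
      rw [hfp]; push_cast; exact inv_mul_cancel₀ hp0
    refine ⟨fun z => ((p.factorial : ℝ)⁻¹ : ℝ) * iteratedDeriv p f z, (hD p).const_mul _, hq0,
      fun z _ => ?_, fun z hz => ⟨?_, hargq z hz⟩⟩
    · push_cast
      simp [hp0]
    · exact mem_slitPlane_of_abs_arg_lt
        (g := fun z => ((p.factorial : ℝ)⁻¹ : ℝ) * iteratedDeriv p f z)
        (by nlinarith) ((hD p).const_mul _) (by rw [hq0]; exact one_ne_zero) hargq hz
  | succ k ih =>
    obtain ⟨q, hq, hq0, hqf, hqarg⟩ := ih (by omega)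
    obtain ⟨Q, hQ, hQf⟩ := exists_differentiableOn_eq_pow_mul one_pos (hD (p - (k + 1)))
      (k := k + 1) (fun j hj => by
        rw [iteratedDeriv_eq_iterate, iteratedDeriv_eq_iterate, ← Function.iterate_add_apply,
          ← iteratedDeriv_eq_iterate]
        exact hf0 _ (by omega))
    have hrel : ∀ z ∈ ball (0 : ℂ) 1,
        (p.factorial / k.factorial : ℝ) * q z = (k + 1) * Q z + z * deriv Q z := fun z hz => by
      refine eq_add_mul_deriv_of_deriv_pow_mul
        (P := fun z => (p.factorial / k.factorial : ℝ) * q z) (hq.const_mul _) hQ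
        (fun w hw => ?_) hz
      rw [← funext hQf, ← iteratedDeriv_succ, show p - (k + 1) + 1 = p - k by omega, hqf w hw]
      ring
    have hk0 : (k.factorial : ℂ) ≠ 0 := by exact_mod_cast k.factorial_ne_zero
    have hk1 : (k + 1 : ℂ) ≠ 0 := by exact_mod_cast k.succ_ne_zero
    set c : ℂ := ((k + 1).factorial : ℂ) / p.factorial with hc
    have hck : c = (k + 1) * k.factorial / p.factorial := by
      rw [hc, Nat.factorial_succ]; push_cast; ring
    have hc0 : c * Q 0 = 1 := by
      have := hrel 0 (mem_ball_self one_pos)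
      rw [hq0] at this
      push_cast at this
      rw [hck]
      field_simp at this ⊢
      linear_combination -this
    have hrel' : ∀ z ∈ ball (0 : ℂ) 1,
        c * Q z + z * deriv (fun z => c * Q z) z / ((k + 1 : ℕ) : ℝ) = q z := fun z hz => by
      have := hrel z hz
      push_cast at this
      rw [deriv_const_mul_field, hck]
      push_cast
      field_simp at this ⊢
      linear_combination -this
    refine ⟨fun z => c * Q z, hQ.const_mul _, hc0, fun z hz => ?_, fun z hz => ?_⟩
    · rw [hQf, hc]
      have hk2 : ((k + 1).factorial : ℂ) ≠ 0 := by exact_mod_cast (k + 1).factorial_ne_zero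
      push_cast
      field_simp
    · refine abs_arg_lt_of_abs_arg_add_mul_deriv_lt_s12 (k := ((k + 1 : ℕ) : ℝ)) (hαpos _ hk)
        (hα1 _ (by omega) hk) (by positivity) (hQ.const_mul _) hc0 (fun w hw => ?_) hz
      have hr := hrec (k + 1) (by omega) hk
      rw [Nat.add_sub_cancel] at hr
      have : Real.pi * α k / 2 =
          Real.pi * α (k + 1) / 2 + Real.arctan (α (k + 1) / ((k + 1 : ℕ) : ℝ)) := by
        rw [← hr]; field_simp
      rw [hrel' w hw, ← this]
      exact hqarg w hw

/-- Under the hypotheses of Theorem 4 of the paper, if moreover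
there is `σ ∈ {2,…,p}` with `α σ + α (σ-1) ≤ 1`, then
`|arg(z·f'(z)/f(z))| < π(α (p-1) + α p)/2 ≤ π/2` on the punctured disc, i.e.
`f` is `p`-valently strongly starlike of order `α (p-1) + α p`. -/
theorem stmt_12 (p : ℕ) (hp : 2 ≤ p) (f : ℂ → ℂ)
    (hf : AnalyticOnNhd ℂ f {z : ℂ | ‖z‖ < 1})
    (hf0 : ∀ k < p, iteratedDeriv k f 0 = 0)
    (hfp : iteratedDeriv p f 0 = (p.factorial : ℂ))
    (α₀ : ℝ) (hα₀ : α₀ ∈ Set.Ioc (0 : ℝ) (3 / 2))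
    (α : ℕ → ℝ) (hαpos : ∀ k ≤ p, 0 < α k) (hα0 : α 0 = α₀)
    (hrec : ∀ k, 1 ≤ k → k ≤ p →
      α k + (2 / Real.pi) * Real.arctan (α k / k) = α (k - 1))
    (harg : ∀ z : ℂ, ‖z‖ < 1 →
      |Complex.arg (iteratedDeriv p f z)| < Real.pi * α₀ / 2)
    (σ : ℕ) (hσ : 2 ≤ σ) (hσp : σ ≤ p) (hσsum : α σ + α (σ - 1) ≤ 1) :
    (∀ z : ℂ, ‖z‖ < 1 → z ≠ 0 →
        |Complex.arg (z * deriv f z / f z)| < Real.pi * (α (p - 1) + α p) / 2) ∧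
      Real.pi * (α (p - 1) + α p) / 2 ≤ Real.pi / 2 := by
  have hpi := Real.pi_pos
  have hball : {z : ℂ | ‖z‖ < 1} = ball 0 1 := by ext; simp
  have hdec : ∀ k, k + 1 ≤ p → α (k + 1) ≤ α k := by
    intro k hk
    have h := hrec (k + 1) (by omega) hk
    rw [Nat.add_sub_cancel] at h
    have h2 : 0 < Real.arctan (α (k + 1) / (k + 1 : ℕ)) :=
      Real.arctan_pos.2 (div_pos (hαpos _ hk) (by positivity))
    have := mul_pos (div_pos two_pos hpi) h2
    linarith
  have hanti : ∀ m n, m ≤ n → n ≤ p → α n ≤ α m := by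
    intro m n hmn
    induction n, hmn using Nat.le_induction with
    | base => exact fun _ => le_rfl
    | succ n _ ih => exact fun h => (hdec n h).trans (ih (by omega))
  have hα1 : ∀ k, 1 ≤ k → k ≤ p → α k ≤ 1 := by
    intro k hk hkp
    refine (hanti 1 k hk hkp).trans (le_one_of_add_arctan_le ?_)
    have h := hrec 1 le_rfl (by omega)
    rw [Nat.cast_one, div_one, Nat.sub_self, hα0] at h
    exact h.trans_le hα₀.2
  have hsum : α (p - 1) + α p ≤ 1 := by
    have h1 := hanti σ p hσp le_rfl
    have h2 := hanti (σ - 1) (p - 1) (by omega) (by omega)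
    linarith
  have hle : Real.pi * (α (p - 1) + α p) / 2 ≤ Real.pi / 2 := by nlinarith
  refine ⟨fun z hz hz0 => ?_, hle⟩
  have hzb : z ∈ ball (0 : ℂ) 1 := mem_ball_zero_iff.2 hz
  have hexists := fun k (hk : k ≤ p) => exists_normalised_iteratedDeriv
    (hball ▸ hf.differentiableOn) hf0 hfp (hα0.trans_le hα₀.2) hαpos hα1 hrec
    (fun w hw => hα0 ▸ harg w (mem_ball_zero_iff.1 hw)) hk
  obtain ⟨q, -, -, hqf, hq⟩ := hexists p le_rfl
  obtain ⟨r, -, -, hrf, hr⟩ := hexists (p - 1) (by omega)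
  have hqf := hqf z hzb
  have hrf := hrf z hzb
  obtain ⟨hqs, hqa⟩ := hq z hzb
  obtain ⟨hrs, hra⟩ := hr z hzb
  have hq0 := Complex.slitPlane_ne_zero hqs
  have hr0 := Complex.slitPlane_ne_zero hrs
  rw [Nat.sub_self, iteratedDeriv_zero] at hqf
  rw [show p - (p - 1) = 1 by omega, iteratedDeriv_one] at hrf
  have hquot : z * deriv f z / f z = (p : ℝ) * (r z * (q z)⁻¹) := by
    obtain ⟨n, rfl⟩ : ∃ n, p = n + 1 := ⟨p - 1, by omega⟩
    have hn : (n.factorial : ℂ) ≠ 0 := by exact_mod_cast n.factorial_ne_zero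
    have hn1 : (n + 1 : ℂ) ≠ 0 := by exact_mod_cast n.succ_ne_zero
    rw [hqf, hrf, Nat.add_sub_cancel, Nat.factorial_succ]
    push_cast
    field_simp
    ring
  have hinv : Complex.arg (q z)⁻¹ = -Complex.arg (q z) := by
    rw [Complex.arg_inv, if_neg (Complex.mem_slitPlane_iff_arg.1 hqs).1]
  have hra' := abs_lt.1 hra
  have hqa' := abs_lt.1 hqa
  rw [hquot, Complex.arg_real_mul _ (by positivity), Complex.arg_mul hr0 (inv_ne_zero hq0), hinv,
    abs_lt]
  · constructor <;> linarith
  · rw [hinv]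
    constructor <;> linarith
end

section
/- Let p ≥ 1 be an integer and let f(z) = z^p + ∑_{n=p+1}^∞ a_n z^n be analytic in the open unit disc 𝔻. If Re( z·f^{(p)}(z)/f^{(p-1)}(z) ) > 0 for all z ∈ 𝔻 (z ≠ 0), then for every k ∈ {1, …, p} one has Re( z·f^{(k)}(z)/f^{(k-1)}(z) ) > 0 for all z ∈ 𝔻 (z ≠ 0). -/
open Complex Real

open Filter Topology

/-- If an analytic germ vanishes at `0` but not identically, then `h(z) / (z h'(z))` has positive
real part near `0`. -/
lemma eventually_re_div_mul_deriv_pos {h : ℂ → ℂ} (hh : AnalyticAt ℂ h 0) (h0 : h 0 = 0)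
    (hne : ¬ ∀ᶠ z in 𝓝 0, h z = 0) : ∀ᶠ z in 𝓝[≠] (0 : ℂ), 0 < (h z / (z * deriv h z)).re := by
  obtain ⟨m, g, hg, hg0, hhg⟩ := hh.exists_eventuallyEq_pow_smul_nonzero_iff.mpr hne
  simp only [sub_zero, smul_eq_mul] at hhg
  obtain ⟨n, rfl⟩ : ∃ n, m = n + 1 := by
    refine Nat.exists_eq_succ_of_ne_zero ?_
    rintro rfl
    have := hhg.self_of_nhds
    simp_all
  have hn : ((n : ℂ) + 1) ≠ 0 := Nat.cast_add_one_ne_zero n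
  have hlim : ContinuousAt (fun z => g z / ((n + 1) * g z + z * deriv g z)) 0 := by
    have := hg.continuousAt
    have := hg.deriv.continuousAt
    refine ContinuousAt.div (by fun_prop) (by fun_prop) ?_
    simpa using ⟨hn, hg0⟩
  have hpos : ∀ᶠ z in 𝓝 (0 : ℂ), 0 < (g z / ((n + 1) * g z + z * deriv g z)).re := by
    refine (Complex.continuous_re.continuousAt.comp hlim).eventually (lt_mem_nhds ?_)
    have : g 0 / ((n + 1) * g 0 + 0 * deriv g 0) = ((1 / ((n : ℝ) + 1) : ℝ) : ℂ) := by
      push_cast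
      field_simp
      simp
    simp only [Function.comp, this, Complex.ofReal_re]
    positivity
  have hder := hhg.eventually_nhds
  rw [eventually_nhdsWithin_iff]
  filter_upwards [hpos, hder, hg.eventually_analyticAt] with z hz hz' hgz hz0
  have hz0 : z ≠ 0 := hz0
  have hd : deriv h z = z ^ n * ((n + 1) * g z + z * deriv g z) := by
    rw [EventuallyEq.deriv_eq hz']
    refine ((hasDerivAt_pow (n + 1) z).mul hgz.differentiableAt.hasDerivAt).deriv.trans ?_
    simp
    ring
  have heq : h z / (z * deriv h z) = g z / ((n + 1) * g z + z * deriv g z) := by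
    rw [hz'.self_of_nhds, hd, pow_succ, ← mul_div_mul_left (g z) _ (mul_ne_zero (pow_ne_zero n hz0) hz0)]
    ring
  rwa [heq]

/-- If the real part of `u` is minimal at `c` among the points of a disc centred at `0` with `c` on
its boundary, then `c d`, where `d = u'(c)`, is a nonpositive real. -/
lemma re_mul_deriv_nonpos_of_isMinOn {u : ℂ → ℂ} {c d : ℂ} (hu : HasDerivAt u d c)
    (hmin : ∀ᶠ z in 𝓝[Metric.closedBall 0 ‖c‖] c, (u c).re ≤ (u z).re) :
    (c * d).re ≤ 0 ∧ (c * d).im = 0 := by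
  have key : ∀ w : ℂ, ‖w‖ ≤ 1 → 0 ≤ (c * d * (w - 1)).re := by
    intro w hw
    have hF : HasFDerivWithinAt (fun z => (u z).re)
        (Complex.reCLM.comp ((ContinuousLinearMap.toSpanSingleton ℂ d).restrictScalars ℝ))
        (Metric.closedBall 0 ‖c‖) c :=
      (Complex.reCLM.hasFDerivAt.comp c
        (hu.hasFDerivAt.restrictScalars ℝ)).hasFDerivWithinAt
    have hcw : c * w ∈ Metric.closedBall (0 : ℂ) ‖c‖ := by
      simpa using mul_le_of_le_one_right (norm_nonneg c) hw
    have hy := sub_mem_posTangentConeAt_of_segment_subset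
      ((convex_closedBall (0 : ℂ) ‖c‖).segment_subset (mem_closedBall_zero_iff.mpr le_rfl) hcw)
    have := IsLocalMinOn.hasFDerivWithinAt_nonneg (f := fun z => (u z).re) hmin hF hy
    convert this using 1
    simp
    ring
  generalize c * d = ζ at key
  have h1 := key 0 (by simp)
  simp only [zero_sub, mul_neg, mul_one, Complex.neg_re] at h1
  refine ⟨by linarith, ?_⟩
  by_contra him
  have hz : ζ ≠ 0 := fun h => him (by simp [h])
  have hzn : 0 < ‖ζ‖ := norm_pos_iff.mpr hz
  have h2 := key (-(starRingEnd ℂ ζ) / ‖ζ‖) (by simp [hz])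
  have h3 : ζ * (-(starRingEnd ℂ ζ) / ‖ζ‖ - 1) = ((-‖ζ‖ : ℝ) : ℂ) - ζ := by
    have : (‖ζ‖ : ℂ) ≠ 0 := by exact_mod_cast hzn.ne'
    push_cast
    rw [mul_sub, mul_div_assoc', mul_neg, Complex.mul_conj']
    field_simp
  rw [h3, Complex.sub_re, Complex.ofReal_re] at h2
  have h4 := Complex.sq_norm ζ
  rw [Complex.normSq_apply] at h4
  have : 0 < ζ.im * ζ.im := mul_self_pos.mpr him
  nlinarith

/-- If `h` vanishes at `0` and `Re (z h''(z) / h'(z)) > 0` on the punctured unit disc, then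
`Re (z h'(z) / h(z)) > 0` there. -/
lemma re_mul_deriv_div_pos_of_deriv {h : ℂ → ℂ} (hh : AnalyticOnNhd ℂ h {z : ℂ | ‖z‖ < 1})
    (h0 : h 0 = 0)
    (hre : ∀ z : ℂ, ‖z‖ < 1 → z ≠ 0 → 0 < (z * deriv (deriv h) z / deriv h z).re) :
    ∀ z : ℂ, ‖z‖ < 1 → z ≠ 0 → 0 < (z * deriv h z / h z).re := by
  have hd : ∀ z : ℂ, ‖z‖ < 1 → z ≠ 0 → deriv h z ≠ 0 := by
    intro z hz hz0 hz'
    simpa [hz'] using hre z hz hz0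
  have hne : ¬ ∀ᶠ z in 𝓝 0, h z = 0 := by
    intro hev
    have hball : ∀ᶠ z in 𝓝[≠] (0 : ℂ), ‖z‖ < 1 :=
      nhdsWithin_le_nhds (by simpa [Metric.ball] using Metric.ball_mem_nhds (0 : ℂ) one_pos)
    obtain ⟨z, hz, hz1, hz0⟩ :=
      ((hev.eventually_nhds.filter_mono nhdsWithin_le_nhds).and
        (hball.and self_mem_nhdsWithin)).exists
    apply hd z hz1 hz0
    have : h =ᶠ[𝓝 z] fun _ => 0 := hz
    simp [this.deriv_eq]
  set u : ℂ → ℂ := fun z => h z / (z * deriv h z) with hu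
  have hud : ∀ z : ℂ, ‖z‖ < 1 → z ≠ 0 → ∃ d, HasDerivAt u d z ∧
      z * d = 1 - u z * (1 + z * deriv (deriv h) z / deriv h z) := by
    intro z hz hz0
    have e1 := (hh z hz).differentiableAt.hasDerivAt
    have e2 := (hh z hz).deriv.differentiableAt.hasDerivAt
    have hdz := hd z hz hz0
    refine ⟨_, e1.div ((hasDerivAt_id z).mul e2) (mul_ne_zero hz0 hdz), ?_⟩
    simp only [hu, id]
    field_simp
  obtain ⟨ε, hε, hεu⟩ : ∃ ε > 0, ∀ z : ℂ, ‖z‖ < ε → z ≠ 0 → 0 < (u z).re := by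
    have := eventually_re_div_mul_deriv_pos (hh 0 (by simp)) h0 hne
    rw [eventually_nhdsWithin_iff, Metric.eventually_nhds_iff] at this
    simpa using this
  suffices H : ∀ z : ℂ, ‖z‖ < 1 → z ≠ 0 → 0 < (u z).re by
    intro z hz hz0
    have hinv : z * deriv h z / h z = (u z)⁻¹ := by simp [hu]
    have hu0 : u z ≠ 0 := fun h' => by simpa [h'] using H z hz hz0
    rw [hinv, Complex.inv_re]
    exact div_pos (H z hz hz0) (Complex.normSq_pos.mpr hu0)
  by_contra! hcon
  obtain ⟨z₁, hz₁, hz₁0, hz₁u⟩ := hcon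
  set A : Set ℂ := Metric.closedBall 0 ‖z₁‖ ∩ {z | ε ≤ ‖z‖} with hA
  have hAc : IsCompact A :=
    (isCompact_closedBall _ _).inter_right (isClosed_le continuous_const continuous_norm)
  have hA1 : ∀ z ∈ A, ‖z‖ < 1 ∧ z ≠ 0 := by
    rintro z ⟨hz, hz'⟩
    exact ⟨(mem_closedBall_zero_iff.mp hz).trans_lt hz₁, norm_pos_iff.mp (hε.trans_le hz')⟩
  have hcont : ContinuousOn (fun z => (u z).re) A := fun z hz => by
    obtain ⟨d, hd, -⟩ := hud z (hA1 z hz).1 (hA1 z hz).2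
    exact (Complex.continuous_re.continuousAt.comp hd.continuousAt).continuousWithinAt
  have hK : IsCompact (A ∩ (fun z => (u z).re) ⁻¹' Set.Iic 0) :=
    hAc.of_isClosed_subset (hcont.preimage_isClosed_of_isClosed hAc.isClosed isClosed_Iic)
      Set.inter_subset_left
  have hz₁ε : ε ≤ ‖z₁‖ := by
    by_contra! hlt
    exact (hεu z₁ hlt hz₁0).not_ge hz₁u
  obtain ⟨c, ⟨hcA, hcu⟩, hcmin⟩ := hK.exists_isMinOn
    ⟨z₁, ⟨by simp, hz₁ε⟩, hz₁u⟩ continuous_norm.continuousOn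
  obtain ⟨hc1, hc0⟩ := hA1 c hcA
  have hcz₁ : ‖c‖ ≤ ‖z₁‖ := mem_closedBall_zero_iff.mp hcA.1
  replace hcu : (u c).re ≤ 0 := hcu
  have hlt : ∀ z : ℂ, ‖z‖ < ‖c‖ → z ≠ 0 → 0 < (u z).re := by
    intro z hz hz0
    by_contra! hle
    rcases lt_or_ge ‖z‖ ε with hzε | hzε
    · exact (hεu z hzε hz0).not_ge hle
    · exact (hcmin ⟨⟨mem_closedBall_zero_iff.mpr (hz.le.trans hcz₁), hzε⟩, hle⟩).not_gt hz
  have hcle : ∀ z : ℂ, ‖z‖ ≤ ‖c‖ → z ≠ 0 → 0 ≤ (u z).re := by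
    intro z hz hz0
    obtain ⟨d, hd, -⟩ := hud z (hz.trans_lt hc1) hz0
    have hray : Tendsto (fun t : ℝ => (t : ℂ) * z) (𝓝[<] 1) (𝓝 z) := by
      have : Continuous fun t : ℝ => (t : ℂ) * z := by fun_prop
      simpa using (this.tendsto 1).mono_left nhdsWithin_le_nhds
    refine ge_of_tendsto ((Complex.continuous_re.continuousAt.comp hd.continuousAt).tendsto.comp
      hray) ?_
    filter_upwards [Ioo_mem_nhdsLT (zero_lt_one (α := ℝ))] with t ht
    refine (hlt _ ?_ (mul_ne_zero (by exact_mod_cast ht.1.ne') hz0)).le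
    rw [norm_mul, Complex.norm_real, Real.norm_of_nonneg ht.1.le]
    have := norm_pos_iff.mpr hz0
    nlinarith [ht.2]
  have hcre : (u c).re = 0 := le_antisymm hcu (hcle c le_rfl hc0)
  obtain ⟨d, hd, hode⟩ := hud c hc1 hc0
  obtain ⟨hr, hi⟩ := re_mul_deriv_nonpos_of_isMinOn hd (by
    filter_upwards [self_mem_nhdsWithin, nhdsWithin_le_nhds (isOpen_ne.mem_nhds hc0)] with z hz hz0
    exact hcre.trans_le (hcle z (mem_closedBall_zero_iff.mp hz) hz0))
  have hP := hre c hc1 hc0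
  rw [hode] at hr hi
  simp only [Complex.sub_re, Complex.sub_im, Complex.mul_re, Complex.mul_im, Complex.add_re,
    Complex.add_im, Complex.one_re, Complex.one_im, hcre] at hr hi
  generalize c * deriv (deriv h) c / deriv h c = Q at *
  have him : (u c).im = 0 := by
    have : (u c).im * (1 + Q.re) = 0 := by linarith
    exact (mul_eq_zero.mp this).resolve_right (by linarith)
  rw [him] at hr
  linarith

/-- If `f(z) = z^p + ⋯` is analytic in the unit disc and
`Re(z·f^{(p)}(z)/f^{(p-1)}(z)) > 0` on the punctured disc, then for every
`k ∈ {1,…,p}`, `Re(z·f^{(k)}(z)/f^{(k-1)}(z)) > 0` on the punctured disc. -/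
theorem stmt_16 (p : ℕ) (hp : 1 ≤ p) (f : ℂ → ℂ)
    (hf : AnalyticOnNhd ℂ f {z : ℂ | ‖z‖ < 1})
    (hf0 : ∀ k < p, iteratedDeriv k f 0 = 0)
    (hfp : iteratedDeriv p f 0 = (p.factorial : ℂ))
    (hre : ∀ z : ℂ, ‖z‖ < 1 → z ≠ 0 →
      0 < (z * iteratedDeriv p f z / iteratedDeriv (p - 1) f z).re) :
    ∀ k, 1 ≤ k → k ≤ p → ∀ z : ℂ, ‖z‖ < 1 → z ≠ 0 →
      0 < (z * iteratedDeriv k f z / iteratedDeriv (k - 1) f z).re := by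
  intro k hk hkp
  induction hkp using Nat.decreasingInduction with
  | self => exact hre
  | of_succ k hkp ih =>
    obtain ⟨j, rfl⟩ : ∃ j, k = j + 1 := Nat.exists_eq_add_of_le' hk
    have ih := ih (by omega)
    simp only [Nat.add_sub_cancel, iteratedDeriv_succ] at ih ⊢
    refine re_mul_deriv_div_pos_of_deriv ?_ (hf0 j (by omega)) ih
    rw [iteratedDeriv_eq_iterate]
    exact hf.iterated_deriv j
end
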